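/- arXiv:1404.7034 — 6 statements merged into one kernel-verified Lean document; each statement's English description precedes it below -/
import Mathlib

section
/- Let X be a totally disconnected compact metric space, let Ω be a nonempty connected compact metric space, and let β : X × Ω → X × Ω be a homeomorphism. Then there exist a homeomorphism γ : X → X and, for each x ∈ X, a homeomorphism φ_x : Ω → Ω, such that β(x, ξ) = (γ(x), φ_x(ξ)) for all (x, ξ) ∈ X × Ω; moreover, the maps (x, ξ) ↦ φ_x(ξ) and (x, ξ) ↦ φ_x^{-1}(ξ) from X × Ω to Ω are jointly continuous. -/
/-- A continuous map from a product with preconnected second factor to a totally disconnected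
space does not depend on the second coordinate. -/
theorem Continuous.apply_prodMk_eq_of_totallyDisconnected {X Y Z : Type*} [TopologicalSpace X]
    [TopologicalSpace Y] [TopologicalSpace Z] [PreconnectedSpace Y] [TotallyDisconnectedSpace Z]
    {f : X × Y → Z} (hf : Continuous f) (x : X) (y y' : Y) : f (x, y) = f (x, y') :=
  (isPreconnected_range (hf.comp (Continuous.prodMk_right x))).subsingleton
    (Set.mem_range_self y) (Set.mem_range_self y')

/-- Let `X` be a totally disconnected compact metric space, `Ω` a nonempty connected
compact metric space, and `β : X × Ω → X × Ω` a homeomorphism.  Then there are a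
homeomorphism `γ : X → X` and homeomorphisms `φ x : Ω → Ω` for `x ∈ X` such that
`β (x, ξ) = (γ x, φ x ξ)`, and moreover `(x, ξ) ↦ φ x ξ` and `(x, ξ) ↦ (φ x)⁻¹ ξ`
are jointly continuous. -/
theorem stmt0 {X Ω : Type*} [MetricSpace X] [CompactSpace X] [TotallyDisconnectedSpace X]
    [MetricSpace Ω] [CompactSpace Ω] [ConnectedSpace Ω]
    (β : (X × Ω) ≃ₜ (X × Ω)) :
    ∃ (γ : X ≃ₜ X) (φ : X → (Ω ≃ₜ Ω)),
      (∀ (x : X) (ξ : Ω), β (x, ξ) = (γ x, φ x ξ)) ∧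
      Continuous (fun p : X × Ω => φ p.1 p.2) ∧
      Continuous (fun p : X × Ω => (φ p.1).symm p.2) := by
  obtain ⟨ω⟩ : Nonempty Ω := inferInstance
  have fst_eq (x : X) (ξ η : Ω) : (β (x, ξ)).1 = (β (x, η)).1 :=
    (continuous_fst.comp β.continuous).apply_prodMk_eq_of_totallyDisconnected x ξ η
  have symm_fst_eq (x : X) (ξ η : Ω) : (β.symm (x, ξ)).1 = (β.symm (x, η)).1 :=
    (continuous_fst.comp β.symm.continuous).apply_prodMk_eq_of_totallyDisconnected x ξ η
  let γ : X ≃ₜ X :=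
    { toFun := fun x => (β (x, ω)).1
      invFun := fun x => (β.symm (x, ω)).1
      left_inv := fun x => by
        beta_reduce
        rw [symm_fst_eq _ ω (β (x, ω)).2, Prod.mk.eta, β.symm_apply_apply]
      right_inv := fun x => by
        beta_reduce
        rw [fst_eq _ ω (β.symm (x, ω)).2, Prod.mk.eta, β.apply_symm_apply]
      continuous_toFun := by fun_prop
      continuous_invFun := by fun_prop }
  have apply_eq (x : X) (ξ : Ω) : β (x, ξ) = (γ x, (β (x, ξ)).2) :=
    Prod.ext (fst_eq x ξ ω) rfl
  have symm_apply_eq (x : X) (ξ : Ω) : β.symm (γ x, ξ) = (x, (β.symm (γ x, ξ)).2) :=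
    Prod.ext ((symm_fst_eq (γ x) ξ ω).trans (γ.symm_apply_apply x)) rfl
  let φ (x : X) : Ω ≃ₜ Ω :=
    { toFun := fun ξ => (β (x, ξ)).2
      invFun := fun ξ => (β.symm (γ x, ξ)).2
      left_inv := fun ξ => by
        beta_reduce
        rw [← apply_eq, β.symm_apply_apply]
      right_inv := fun ξ => by
        beta_reduce
        rw [← symm_apply_eq, β.apply_symm_apply]
      continuous_toFun := by fun_prop
      continuous_invFun := by fun_prop }
  refine ⟨γ, φ, apply_eq, continuous_snd.comp β.continuous, ?_⟩
  change Continuous fun p : X × Ω => (β.symm (γ p.1, p.2)).2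
  fun_prop
end

section
/- Let Y be a compact Hausdorff space such that every unitary element of C(Y, ℂ) is joined to the constant function 1 by a continuous path inside the set of unitary elements of C(Y, ℂ). Then for every integer m ≥ 1 and every unitary element w of the matrix algebra M_m(C(Y, ℂ)), there exists a unitary element v of M_m(C(Y, ℂ)) such that det(v(y)) = 1 for every y ∈ Y and such that v is joined to w by a continuous path inside the set of unitary elements of M_m(C(Y, ℂ)). -/
/-- The diagonal matrix with entry `z` at the index `i` and `1` elsewhere on the diagonal, as a
continuous function of `z`. -/
noncomputable def diagonalUpdate {n : Type*} [DecidableEq n] (i : n) : C(ℂ, Matrix n n ℂ) where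
  toFun z := Matrix.diagonal (Function.update 1 i z)
  continuous_toFun := by fun_prop

theorem det_diagonalUpdate {n : Type*} [DecidableEq n] [Fintype n] (i : n) (z : ℂ) :
    (diagonalUpdate i z).det = z := by
  simp [diagonalUpdate, Matrix.det_diagonal, Finset.prod_update_of_mem]

theorem diagonalUpdate_one {n : Type*} [DecidableEq n] (i : n) : diagonalUpdate i 1 = 1 := by
  change Matrix.diagonal (Function.update 1 i ((1 : n → ℂ) i)) = 1
  rw [Function.update_eq_self]
  exact Matrix.diagonal_one

theorem diagonalUpdate_mul {n : Type*} [DecidableEq n] [Fintype n] (i : n) (z z' : ℂ) :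
    diagonalUpdate i z * diagonalUpdate i z' = diagonalUpdate i (z * z') := by
  simp only [diagonalUpdate, ContinuousMap.coe_mk, Matrix.diagonal_mul_diagonal]
  congr 1
  ext j
  by_cases hj : j = i
  · subst hj; simp
  · simp [hj]

theorem star_diagonalUpdate {n : Type*} [DecidableEq n] [Fintype n] (i : n) (z : ℂ) :
    star (diagonalUpdate i z) = diagonalUpdate i (star z) := by
  simp only [diagonalUpdate, ContinuousMap.coe_mk, Matrix.star_eq_conjTranspose,
    Matrix.diagonal_conjTranspose]
  congr 1
  ext j
  by_cases hj : j = i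
  · subst hj; simp
  · simp [hj]

/-- The embedding of the unitaries of `C(Y, ℂ)` into those of `C(Y, Matrix n n ℂ)` sending `u` to
the diagonal matrix with entry `u` at the index `i` and `1` elsewhere on the diagonal. -/
noncomputable def unitaryDiagonalUpdate {Y n : Type*} [TopologicalSpace Y] [DecidableEq n] [Fintype n] (i : n)
    (u : unitary C(Y, ℂ)) : unitary C(Y, Matrix n n ℂ) :=
  ⟨(diagonalUpdate i).comp u.1, by
    have h₁ := fun y => DFunLike.congr_fun (Unitary.star_mul_self_of_mem u.2) y
    have h₂ := fun y => DFunLike.congr_fun (Unitary.mul_star_self_of_mem u.2) y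
    simp only [ContinuousMap.mul_apply, ContinuousMap.star_apply, ContinuousMap.one_apply] at h₁ h₂
    rw [Unitary.mem_iff]
    constructor <;> ext1 y <;>
      simp only [ContinuousMap.mul_apply, ContinuousMap.star_apply, ContinuousMap.one_apply,
        ContinuousMap.comp_apply, star_diagonalUpdate, diagonalUpdate_mul, h₁, h₂,
        diagonalUpdate_one]⟩

theorem continuous_unitaryDiagonalUpdate {Y n : Type*} [TopologicalSpace Y] [DecidableEq n]
    [Fintype n] (i : n) :
    Continuous (unitaryDiagonalUpdate i : unitary C(Y, ℂ) → unitary C(Y, Matrix n n ℂ)) :=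
  ((ContinuousMap.continuous_postcomp (diagonalUpdate i)).comp continuous_subtype_val).subtype_mk _

theorem unitaryDiagonalUpdate_one {Y n : Type*} [TopologicalSpace Y] [DecidableEq n]
    [Fintype n] (i : n) : unitaryDiagonalUpdate i (1 : unitary C(Y, ℂ)) = 1 :=
  Subtype.ext <| ContinuousMap.ext fun _ => diagonalUpdate_one i

/-- The pointwise determinant of a unitary of `C(Y, Matrix n n ℂ)`. -/
noncomputable def unitaryDet {Y n : Type*} [TopologicalSpace Y] [DecidableEq n] [Fintype n]
    (w : unitary C(Y, Matrix n n ℂ)) : unitary C(Y, ℂ) :=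
  ⟨⟨fun y => (w.1 y).det, w.1.continuous.matrix_det⟩, by
    have h₁ := fun y => DFunLike.congr_fun (Unitary.star_mul_self_of_mem w.2) y
    simp only [ContinuousMap.mul_apply, ContinuousMap.star_apply, ContinuousMap.one_apply] at h₁
    have h₂ : ∀ y, star (w.1 y).det * (w.1 y).det = 1 := fun y => by
      rw [← Matrix.det_conjTranspose, ← Matrix.star_eq_conjTranspose, ← Matrix.det_mul, h₁,
        Matrix.det_one]
    rw [Unitary.mem_iff]
    exact ⟨ContinuousMap.ext h₂, ContinuousMap.ext fun y => (mul_comm _ _).trans (h₂ y)⟩⟩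


/-- Let `Y` be a compact Hausdorff space such that every unitary of `C(Y, ℂ)` is joined
to `1` by a continuous path of unitaries.  Then for every `m ≥ 1` and every unitary
`w` of `M_m(C(Y, ℂ)) ≅ C(Y, M_m(ℂ))` there is a unitary `v` with `det (v y) = 1` for
all `y` which is joined to `w` by a continuous path of unitaries. -/
theorem stmt2 {Y : Type*} [TopologicalSpace Y] [CompactSpace Y] [T2Space Y]
    (h : ∀ u : unitary C(Y, ℂ), Joined u 1) :
    ∀ m : ℕ, 1 ≤ m →
      ∀ w : unitary C(Y, Matrix (Fin m) (Fin m) ℂ),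
        ∃ v : unitary C(Y, Matrix (Fin m) (Fin m) ℂ),
          (∀ y : Y, ((v : C(Y, Matrix (Fin m) (Fin m) ℂ)) y).det = 1) ∧
          Joined v w := by
  intro m hm w
  let i : Fin m := ⟨0, hm⟩
  refine ⟨w * unitaryDiagonalUpdate i (star (unitaryDet w)), fun y => ?_, ?_⟩
  · have hy := DFunLike.congr_fun (Unitary.mul_star_self_of_mem (unitaryDet w).2) y
    change (w.1 y * diagonalUpdate i (star (w.1 y).det)).det = 1
    rw [Matrix.det_mul, det_diagonalUpdate]
    exact hy
  · have hj := (h (star (unitaryDet w))).map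
      (continuous_const.mul (continuous_unitaryDiagonalUpdate i) :
        Continuous fun u => w * unitaryDiagonalUpdate i u)
    simpa only [Pi.mul_apply, unitaryDiagonalUpdate_one, mul_one] using hj
end

section
/- The odometer map α is minimal; in fact, for every x ∈ X the forward orbit {x + n·1̲ : n ∈ ℕ} is dense in X. -/
/-- Two threads of the inverse system that agree at level `k` agree at all levels `n ≤ k`. -/
theorem thread_eq_of_le (m : ℕ → ℕ) (hdvd : ∀ n, m n ∣ m (n + 1)) {x y : ∀ n, ZMod (m n)}
    (hx : ∀ n, ZMod.castHom (hdvd n) (ZMod (m n)) (x (n + 1)) = x n)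
    (hy : ∀ n, ZMod.castHom (hdvd n) (ZMod (m n)) (y (n + 1)) = y n)
    {n k : ℕ} (hnk : n ≤ k) (h : x k = y k) : x n = y n := by
  induction k, hnk using Nat.le_induction with
  | base => exact h
  | succ k _ ih => exact ih (by rw [← hx k, ← hy k, h])

/-- In the inverse limit of the `ZMod (m n)`, every forward orbit of translation by `1` is dense. -/
theorem mem_closure_forward_orbit (m : ℕ → ℕ) (hm : ∀ n, m n ≠ 0)
    (hdvd : ∀ n, m n ∣ m (n + 1)) {x y : ∀ n, ZMod (m n)}
    (hx : ∀ n, ZMod.castHom (hdvd n) (ZMod (m n)) (x (n + 1)) = x n)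
    (hy : ∀ n, ZMod.castHom (hdvd n) (ZMod (m n)) (y (n + 1)) = y n) :
    y ∈ closure {z | ∃ j : ℕ, z = x + j • (1 : ∀ n, ZMod (m n))} := by
  rw [mem_closure_iff]
  intro o ho hyo
  obtain ⟨I, u, hu, hsub⟩ := isOpen_pi_iff.1 ho y hyo
  set k := I.sup id
  have : NeZero (m k) := ⟨hm k⟩
  set j := (y k - x k).val
  refine ⟨x + j • 1, hsub fun n hn => ?_, j, rfl⟩
  have hthread : ∀ n, ZMod.castHom (hdvd n) (ZMod (m n))
      ((x + j • (1 : ∀ n, ZMod (m n))) (n + 1)) = (x + j • (1 : ∀ n, ZMod (m n))) n := by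
    intro n
    simp only [Pi.add_apply, Pi.smul_apply, Pi.one_apply, map_add, map_nsmul, map_one, hx n]
  have hk : (x + j • (1 : ∀ n, ZMod (m n))) k = y k := by
    rw [Pi.add_apply, Pi.smul_apply, Pi.one_apply, nsmul_one, ZMod.natCast_zmod_val,
      add_sub_cancel]
  have hnk : n ≤ k := Finset.le_sup (f := id) hn
  rw [thread_eq_of_le m hdvd hthread hy hnk hk]
  exact (hu n hn).2

/-- Let `m : ℕ → ℕ` with `2 ≤ m n` and `m n ∣ m (n+1)`, and let `X` be the odometer
space, realized as the inverse limit of the `ZMod (m n)` inside the product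
`∀ n, ZMod (m n)` of discrete spaces.  Then the odometer map `α` (translation by the
all-ones element `1`) is minimal: every `ℤ`-orbit `{x + n • 1 : n ∈ ℤ}` is dense in
`X`; in fact every forward orbit `{x + j • 1 : j ∈ ℕ}` is dense in `X`. -/
theorem stmt4 (m : ℕ → ℕ) (h2 : ∀ n, 2 ≤ m n) (hdvd : ∀ n, m n ∣ m (n + 1))
    (X : Set (∀ n, ZMod (m n)))
    (hX : X = {x | ∀ n, ZMod.castHom (hdvd n) (ZMod (m n)) (x (n + 1)) = x n}) :
    (∀ x ∈ X, X ⊆ closure {y | ∃ n : ℤ, y = x + n • (1 : ∀ n, ZMod (m n))}) ∧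
    (∀ x ∈ X, X ⊆ closure {y | ∃ j : ℕ, y = x + j • (1 : ∀ n, ZMod (m n))}) := by
  subst hX
  have hm : ∀ n, m n ≠ 0 := fun n => by have := h2 n; omega
  have forward := fun x hx y hy => mem_closure_forward_orbit m hm hdvd (x := x) (y := y) hx hy
  refine ⟨fun x hx y hy => closure_mono ?_ (forward x hx y hy), forward⟩
  rintro _ ⟨j, rfl⟩
  exact ⟨j, by rw [natCast_zsmul]⟩
end

section
/- Let Ω be a compact metric space and let β : Ω → Ω be a homeomorphism such that β^m is minimal for every integer m ≥ 1. Then the homeomorphism α × β of X × Ω defined by (α × β)(x, ω) = (α(x), β(ω)) is minimal. -/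
/-- Two coherent sequences that agree at one coordinate agree at all smaller ones. -/
theorem odometer_eq_of_le {m : ℕ → ℕ} (hdvd : ∀ n, m n ∣ m (n + 1))
    {x y : ∀ n, ZMod (m n)}
    (hx : ∀ n, ZMod.castHom (hdvd n) (ZMod (m n)) (x (n + 1)) = x n)
    (hy : ∀ n, ZMod.castHom (hdvd n) (ZMod (m n)) (y (n + 1)) = y n)
    {i N : ℕ} (hi : i ≤ N) (h : x N = y N) : x i = y i := by
  induction N, hi using Nat.le_induction with
  | base => exact h
  | succ N _ ih => exact ih (by rw [← hx N, ← hy N, h])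

/-- Let `X ⊆ ∀ n, ZMod (m n)` be the odometer space with odometer map `α` (translation
by the all-ones element `1`), and let `β` be a homeomorphism of a compact metric space
`Ω` such that `β ^ m` is minimal for every `m ≥ 1`.  Then `α × β` is a minimal
homeomorphism of `X × Ω`: for every point `(x, ω)` of `X × Ω`, its `ℤ`-orbit
`{(x + n • 1, β^n ω) : n ∈ ℤ}` is dense in `X × Ω`. -/
theorem stmt5 (m : ℕ → ℕ) (h2 : ∀ n, 2 ≤ m n) (hdvd : ∀ n, m n ∣ m (n + 1))
    (X : Set (∀ n, ZMod (m n)))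
    (hX : X = {x | ∀ n, ZMod.castHom (hdvd n) (ZMod (m n)) (x (n + 1)) = x n})
    {Ω : Type*} [MetricSpace Ω] [CompactSpace Ω] (β : Ω ≃ₜ Ω)
    (hβ : ∀ k : ℕ, 1 ≤ k → ∀ ω : Ω,
      Dense {ζ | ∃ n : ℤ, ζ = ((β.toEquiv ^ k) ^ n) ω}) :
    ∀ x ∈ X, ∀ ω : Ω, ∀ z ∈ X, ∀ ζ : Ω,
      ((z, ζ) : (∀ n, ZMod (m n)) × Ω) ∈ closure
        {p : (∀ n, ZMod (m n)) × Ω |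
          ∃ n : ℤ, p = (x + n • (1 : ∀ n, ZMod (m n)), (β.toEquiv ^ n) ω)} := by
  subst hX
  intro x hx ω z hz ζ
  rw [mem_closure_iff]
  intro U hU hzU
  obtain ⟨A, V, hA, hV, hzA, hζV, hAV⟩ := isOpen_prod_iff.1 hU z ζ hzU
  obtain ⟨I, u, hu, huA⟩ := isOpen_pi_iff.1 hA z hzA
  set N := I.sup id
  obtain ⟨a, ha⟩ := ZMod.intCast_surjective (z N - x N)
  obtain ⟨_, ⟨k, rfl⟩, hkV⟩ :=
    (hβ (m N) (one_le_two.trans (h2 N)) ((β.toEquiv ^ a) ω)).exists_mem_open hV ⟨ζ, hζV⟩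
  refine ⟨_, hAV ⟨huA fun i hi => ?_, ?_⟩, (m N : ℤ) * k + a, rfl⟩
  · have hw : ∀ n, ZMod.castHom (hdvd n) (ZMod (m n))
        ((x + ((m N : ℤ) * k + a) • (1 : ∀ n, ZMod (m n))) (n + 1)) =
        (x + ((m N : ℤ) * k + a) • (1 : ∀ n, ZMod (m n))) n := fun n => by
      simp only [Pi.add_apply, Pi.smul_apply, Pi.one_apply, map_add, map_zsmul, map_one, hx n]
    have hiN : i ≤ N := Finset.le_sup (f := id) hi
    dsimp only
    rw [odometer_eq_of_le hdvd hw hz hiN (by simp [ha])]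
    exact (hu i hi).2
  · simpa [zpow_add, zpow_mul] using hkV
end

section
/- Let X be a totally disconnected compact metric space and let Ω be a compact metric space such that every continuous map from Ω to the unit circle S¹ = {z ∈ ℂ : |z| = 1} is homotopic to a constant map. Then every continuous map from X × Ω to S¹ is homotopic to a constant map. -/
open Topology Set

/-- A map to the circle homotopic to a constant map has a continuous real logarithm. -/
theorem Circle.exists_lift_of_homotopic_const {Ω : Type*} [TopologicalSpace Ω]
    {f : C(Ω, Circle)} {z : Circle} (hf : f.Homotopic (ContinuousMap.const Ω z)) :
    ∃ θ : C(Ω, ℝ), ∀ ω, Circle.exp (θ ω) = f ω := by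
  obtain ⟨H⟩ := hf.symm
  have H_zero (ω : Ω) : H.toContinuousMap (0, ω) =
      Circle.exp (ContinuousMap.const Ω (Complex.arg z) ω) := by
    simp [Circle.exp_arg]
  refine ⟨(Circle.isCoveringMap_exp.liftHomotopy H.toContinuousMap _ H_zero).comp
    ((ContinuousMap.const Ω 1).prodMk (ContinuousMap.id Ω)), fun ω ↦ ?_⟩
  exact (congr_fun (Circle.isCoveringMap_exp.liftHomotopy_lifts H.toContinuousMap _ H_zero)
    (1, ω)).trans (H.apply_one ω)

/-- A map to the circle with a continuous real logarithm is homotopic to the constant map `1`. -/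
theorem Circle.homotopic_one_of_lift {Y : Type*} [TopologicalSpace Y]
    {g : C(Y, Circle)} {φ : Y → ℝ} (hφ : Continuous φ) (hg : ∀ y, Circle.exp (φ y) = g y) :
    g.Homotopic (ContinuousMap.const Y 1) := by
  refine ⟨⟨⟨fun p ↦ Circle.exp ((1 - (p.1 : ℝ)) * φ p.2), by fun_prop⟩, fun y ↦ ?_, fun y ↦ ?_⟩⟩
  · simp [hg]
  · simp

/-- If a slice `g (x, ·)` has a continuous real logarithm, then so does `g` on a clopen tube
around that slice. -/
theorem Circle.exists_isClopen_lift {X Ω : Type*} [TopologicalSpace X] [CompactSpace X] [T2Space X]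
    [TotallyDisconnectedSpace X] [TopologicalSpace Ω] [CompactSpace Ω] (g : C(X × Ω, Circle))
    {x : X} (θ : C(Ω, ℝ)) (hθ : ∀ ω, Circle.exp (θ ω) = g (x, ω)) :
    ∃ U : Set X, IsClopen U ∧ x ∈ U ∧ ∃ φ : X × Ω → ℝ,
      ∀ p : X × Ω, p.1 ∈ U → ContinuousAt φ p ∧ Circle.exp (φ p) = g p := by
  let q : X × Ω → Circle := fun p ↦ g p / g (x, p.2)
  have hq : Continuous fun p ↦ (q p : ℂ) := by fun_prop
  obtain ⟨u, v, hu, -, hxu, hv, huv⟩ := generalized_tube_lemma (isCompact_singleton (x := x))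
    (isCompact_univ (X := Ω)) (Complex.isOpen_slitPlane.preimage hq) (by
      rintro ⟨y, ω⟩ ⟨rfl, -⟩
      simp [q])
  obtain ⟨U, hU, hxU, hUu⟩ := compact_exists_isClopen_in_isOpen hu (hxu rfl)
  refine ⟨U, hU, hxU, fun p ↦ Complex.arg (q p) + θ p.2, fun p hp ↦ ⟨?_, ?_⟩⟩
  · have hp' : (q p : ℂ) ∈ Complex.slitPlane := huv ⟨hUu hp, hv (mem_univ p.2)⟩
    exact ((Complex.continuousAt_arg hp').comp (f := fun p ↦ (q p : ℂ)) hq.continuousAt).add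
      (by fun_prop)
  · rw [Circle.exp_add, Circle.exp_arg, hθ, div_mul_cancel]

/-- If each slice `g (x, ·)` has a continuous real logarithm and `X` is profinite, then `g` has a
continuous real logarithm. -/
theorem Circle.exists_lift_of_slices {X Ω : Type*} [TopologicalSpace X] [CompactSpace X]
    [T2Space X] [TotallyDisconnectedSpace X] [TopologicalSpace Ω] [CompactSpace Ω]
    (g : C(X × Ω, Circle))
    (hg : ∀ x, ∃ θ : C(Ω, ℝ), ∀ ω, Circle.exp (θ ω) = g (x, ω)) :
    ∃ φ : X × Ω → ℝ, Continuous φ ∧ ∀ p, Circle.exp (φ p) = g p := by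
  classical
  suffices ∃ U : Set X, IsClopen U ∧ univ ⊆ U ∧ ∃ φ : X × Ω → ℝ,
      ∀ p : X × Ω, p.1 ∈ U → ContinuousAt φ p ∧ Circle.exp (φ p) = g p by
    obtain ⟨U, -, hU, φ, hφ⟩ := this
    exact ⟨φ, continuous_iff_continuousAt.2 fun p ↦ (hφ p (hU (mem_univ _))).1,
      fun p ↦ (hφ p (hU (mem_univ _))).2⟩
  refine isCompact_univ.induction_on (p := fun s : Set X ↦ ∃ U : Set X, IsClopen U ∧ s ⊆ U ∧
    ∃ φ : X × Ω → ℝ, ∀ p : X × Ω, p.1 ∈ U → ContinuousAt φ p ∧ Circle.exp (φ p) = g p)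
    ⟨∅, isClopen_empty, subset_rfl, 0, fun p hp ↦ hp.elim⟩ ?_ ?_ ?_
  · rintro s t hst ⟨U, hU, htU, hφ⟩
    exact ⟨U, hU, hst.trans htU, hφ⟩
  · rintro s t ⟨U, hU, hsU, φ, hφ⟩ ⟨V, hV, htV, ψ, hψ⟩
    refine ⟨U ∪ V, hU.union hV, union_subset_union hsU htV,
      fun p ↦ if p.1 ∈ U then φ p else ψ p, fun p hp ↦ ?_⟩
    by_cases hpU : p.1 ∈ U
    · refine ⟨(hφ p hpU).1.congr ?_, by simpa [hpU] using (hφ p hpU).2⟩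
      filter_upwards [(hU.isOpen.preimage continuous_fst).mem_nhds hpU] with y hy
      exact (if_pos hy).symm
    · have hpV := hp.resolve_left hpU
      refine ⟨(hψ p hpV).1.congr ?_, by simpa [hpU] using (hψ p hpV).2⟩
      filter_upwards [(hU.compl.isOpen.preimage continuous_fst).mem_nhds hpU] with y hy
      exact (if_neg hy).symm
  · intro x _
    obtain ⟨θ, hθ⟩ := hg x
    obtain ⟨U, hU, hxU, hφ⟩ := Circle.exists_isClopen_lift g θ hθ
    exact ⟨U, mem_nhdsWithin_of_mem_nhds (hU.isOpen.mem_nhds hxU), U, hU, subset_rfl, hφ⟩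

/-- Let `X` be a totally disconnected compact metric space and `Ω` a compact metric
space such that every continuous map `Ω → S¹` is homotopic to a constant map.  Then
every continuous map `X × Ω → S¹` is homotopic to a constant map. -/
theorem stmt8 {X Ω : Type*} [MetricSpace X] [CompactSpace X] [TotallyDisconnectedSpace X]
    [MetricSpace Ω] [CompactSpace Ω]
    (h : ∀ f : C(Ω, Circle), ∃ z : Circle, f.Homotopic (ContinuousMap.const Ω z)) :
    ∀ g : C(X × Ω, Circle), ∃ z : Circle,
      g.Homotopic (ContinuousMap.const (X × Ω) z) := by
  intro g
  obtain ⟨φ, hφ, hg⟩ := Circle.exists_lift_of_slices g fun x ↦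
    let ⟨_, hz⟩ := h (g.comp ((ContinuousMap.const Ω x).prodMk (ContinuousMap.id Ω)))
    Circle.exists_lift_of_homotopic_const hz
  exact ⟨1, Circle.homotopic_one_of_lift hφ hg⟩
end

section
/- The odometer map α is uniquely ergodic: if ν₁ and ν₂ are Borel probability measures on X that are α-invariant, i.e., the pushforward of ν_i under α equals ν_i for i = 1, 2, then ν₁ = ν₂. -/
open MeasureTheory

/-- A probability measure on `ZMod k` invariant under `x ↦ x + 1` gives every point mass `1 / k`. -/
theorem measure_singleton_of_map_add_one {k : ℕ} [NeZero k] [MeasurableSpace (ZMod k)]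
    [DiscreteMeasurableSpace (ZMod k)] (μ : Measure (ZMod k)) [IsProbabilityMeasure μ]
    (h : μ.map (· + 1) = μ) (a : ZMod k) : μ {a} = (k : ENNReal)⁻¹ := by
  have step (b : ZMod k) : μ {b + 1} = μ {b} := by
    conv_lhs => rw [← h]
    rw [Measure.map_apply .of_discrete .of_discrete]
    congr 1
    ext x
    simp
  have eq_zero (n : ℕ) : μ {(n : ZMod k)} = μ {0} := by
    induction n with
    | zero => simp
    | succ n ih => rw [Nat.cast_succ, step, ih]
  have eq_zero' (b : ZMod k) : μ {b} = μ {0} := by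
    rw [← ZMod.natCast_zmod_val b, eq_zero]
  have total : ∑ b : ZMod k, μ {b} = 1 := by
    rw [sum_measure_singleton, Finset.coe_univ, measure_univ]
  simp only [eq_zero', Finset.sum_const, Finset.card_univ, ZMod.card, nsmul_eq_mul] at total
  rw [eq_zero']
  exact ENNReal.eq_inv_of_mul_eq_one_left (by rwa [mul_comm])

/-- A probability measure on `ZMod k` invariant under `x ↦ x + 1` is unique. -/
theorem eq_of_map_add_one {k : ℕ} [NeZero k] [MeasurableSpace (ZMod k)]
    [DiscreteMeasurableSpace (ZMod k)] (μ ν : Measure (ZMod k)) [IsProbabilityMeasure μ]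
    [IsProbabilityMeasure ν] (hμ : μ.map (· + 1) = μ) (hν : ν.map (· + 1) = ν) : μ = ν :=
  Measure.ext_of_singleton fun a => by
    rw [measure_singleton_of_map_add_one μ hμ, measure_singleton_of_map_add_one ν hν]

/-- The odometer map `α` (translation by the all-ones element) on the odometer space
`X` — the inverse limit of the `ZMod (m n)` realized inside the product
`∀ n, ZMod (m n)` of discrete spaces — is uniquely ergodic: any two `α`-invariant
Borel probability measures on `X` are equal. -/
theorem stmt13 (m : ℕ → ℕ) (h2 : ∀ n, 2 ≤ m n) (hdvd : ∀ n, m n ∣ m (n + 1)) :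
    let X := {x : ∀ n, ZMod (m n) //
      ∀ n, ZMod.castHom (hdvd n) (ZMod (m n)) (x (n + 1)) = x n}
    letI : MeasurableSpace X := borel X
    let α : X → X := fun x => ⟨x.1 + (1 : ∀ n, ZMod (m n)), fun n => by
      simp [map_add, map_one, x.2 n]⟩
    ∀ ν₁ ν₂ : Measure X, IsProbabilityMeasure ν₁ → IsProbabilityMeasure ν₂ →
      ν₁.map α = ν₁ → ν₂.map α = ν₂ → ν₁ = ν₂ := by
  intro X α ν₁ ν₂ _ _ h₁ h₂
  let : MeasurableSpace X := borel X
  have : BorelSpace X := ⟨rfl⟩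
  have (n : ℕ) : NeZero (m n) := ⟨by have := h2 n; omega⟩
  have (n : ℕ) : BorelSpace (ZMod (m n)) := ⟨borel_eq_top_of_discrete.symm⟩
  let π (n : ℕ) (x : X) : ZMod (m n) := x.1 n
  have continuous_π (n : ℕ) : Continuous (π n) := (continuous_apply n).comp continuous_subtype_val
  have measurable_π (n : ℕ) : Measurable (π n) := (continuous_π n).measurable
  have continuous_α : Continuous α :=
    (continuous_subtype_val.add continuous_const).subtype_mk _
  have invariant (ν : Measure X) (h : ν.map α = ν) (n : ℕ) :
      (ν.map (π n)).map (· + 1) = ν.map (π n) := by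
    conv_rhs => rw [← h]
    rw [Measure.map_map .of_discrete (measurable_π n),
      Measure.map_map (measurable_π n) continuous_α.measurable]
    rfl
  have map_eq (n : ℕ) : ν₁.map (π n) = ν₂.map (π n) := by
    have := Measure.isProbabilityMeasure_map (μ := ν₁) (measurable_π n).aemeasurable
    have := Measure.isProbabilityMeasure_map (μ := ν₂) (measurable_π n).aemeasurable
    exact eq_of_map_add_one _ _ (invariant ν₁ h₁ n) (invariant ν₂ h₂ n)
  have factors {n k : ℕ} (hnk : n ≤ k) (s : Set (ZMod (m n))) :
      ∃ t : Set (ZMod (m k)), π k ⁻¹' t = π n ⁻¹' s := by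
    induction k, hnk using Nat.le_induction with
    | base => exact ⟨s, rfl⟩
    | succ k _ ih =>
      obtain ⟨t, ht⟩ := ih
      refine ⟨ZMod.castHom (hdvd k) (ZMod (m k)) ⁻¹' t, ?_⟩
      rw [← ht]
      ext x
      exact iff_of_eq (congrArg (· ∈ t) (x.2 k))
  let C : Set (Set X) := {u | ∃ n, ∃ s : Set (ZMod (m n)), π n ⁻¹' s = u}
  have isPiSystem_C : IsPiSystem C := by
    rintro _ ⟨n, s, rfl⟩ _ ⟨k, t, rfl⟩ -
    obtain ⟨s', hs⟩ := factors (le_max_left n k) s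
    obtain ⟨t', ht⟩ := factors (le_max_right n k) t
    exact ⟨max n k, s' ∩ t', by rw [Set.preimage_inter, hs, ht]⟩
  have generate_C : borel X = MeasurableSpace.generateFrom C := by
    apply le_antisymm
    · have : Measurable[MeasurableSpace.generateFrom C, MeasurableSpace.pi]
          (Subtype.val : X → ∀ n, ZMod (m n)) :=
        @measurable_pi_lambda _ _ _ (MeasurableSpace.generateFrom C) _ _ fun n s _ =>
          MeasurableSpace.measurableSet_generateFrom ⟨n, s, rfl⟩
      have borel_subtype : borel X = MeasurableSpace.comap (Subtype.val : X → ∀ n, ZMod (m n))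
          MeasurableSpace.pi := Subtype.borelSpace (fun x : ∀ n, ZMod (m n) =>
            ∀ n, ZMod.castHom (hdvd n) (ZMod (m n)) (x (n + 1)) = x n) |>.measurable_eq.symm
      rw [borel_subtype]
      exact this.comap_le
    · refine MeasurableSpace.generateFrom_le ?_
      rintro _ ⟨n, s, rfl⟩
      exact measurable_π n .of_discrete
  refine ext_of_generate_finite C generate_C isPiSystem_C ?_ (by simp)
  rintro _ ⟨n, s, rfl⟩
  rw [← Measure.map_apply (measurable_π n) .of_discrete, map_eq,
    Measure.map_apply (measurable_π n) .of_discrete]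
end
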